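/- Assume E[X]>0 and P(Z₁=0|Z₀=1)>0. Then for all k,j ∈ Cl(𝓘) the limits lim_{n→∞}(1/n)·log P_k(Zₙ=j) exist, they all coincide, and they equal lim_{n→∞}(1/n)·log E[Qₙ(z₀)·f_{0,n}(0)^{z₀−1}·∏_{i=1}^{n−1} f_i′(f_{i,n}(0))]. Moreover the common value ρ := −lim_{n→∞}(1/n)·log P_k(Zₙ=j) belongs to [0,∞). -/

import Mathlib

open MeasureTheory ProbabilityTheory Filter Topology

noncomputable section

/-- `q` is a probability mass function on `ℕ`. -/
def IsPMF (q : ℕ → ℝ) : Prop := (∀ k, 0 ≤ q k) ∧ (∑' k, q k) = 1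

/-- Mean `m_q` of a mass function on `ℕ`. -/
def pmfMean (q : ℕ → ℝ) : ℝ := ∑' k : ℕ, (k : ℝ) * q k

/-- `X = log m_Q`. -/
def envX (q : ℕ → ℝ) : ℝ := Real.log (pmfMean q)

/-- Probability generating function of `q`. -/
def pgf (q : ℕ → ℝ) (s : ℝ) : ℝ := ∑' k, q k * s ^ k

/-- Derivative `f'` of the probability generating function of `q`. -/
def dpgf (q : ℕ → ℝ) (s : ℝ) : ℝ := ∑' k : ℕ, (k : ℝ) * q k * s ^ (k - 1)

/-- Second factorial moment `f''(1)` of `q`. -/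
def pgf2 (q : ℕ → ℝ) : ℝ := ∑' k : ℕ, (k : ℝ) * ((k : ℝ) - 1) * q k

/-- Convolution of two mass functions on `ℕ`. -/
def conv (q r : ℕ → ℝ) (k : ℕ) : ℝ := ∑ j ∈ Finset.range (k + 1), q j * r (k - j)

/-- `z`-fold convolution power `q^{*z}`. -/
def convPow (q : ℕ → ℝ) : ℕ → ℕ → ℝ
  | 0 => fun k => if k = 0 then 1 else 0
  | z + 1 => conv q (convPow q z)

/-- Quenched `n`-step transition probabilities of the branching process in the (varying)
environment `e`, where `e i` is the offspring distribution of generation `i + 1`: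
`qtrans e n k j = P(Z_n = j | Z_0 = k, environment e)`. -/
def qtrans (e : ℕ → ℕ → ℝ) : ℕ → ℕ → ℕ → ℝ
  | 0, k, j => if j = k then 1 else 0
  | n + 1, k, j => ∑' i : ℕ, qtrans e n k i * convPow (e n) i j

/-- Composition `f_{i,n} = f_{i+1} ∘ ⋯ ∘ f_n` of generating functions, where `e m` is the
offspring distribution `Q_{m+1}`. -/
def Fcomp (e : ℕ → ℕ → ℝ) (i n : ℕ) (s : ℝ) : ℝ :=
  (List.range (n - i)).foldr (fun m t => pgf (e (i + m)) t) s

/-- Extension of a finite environment to an infinite one (by a trivial environment). -/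
def extEnv (n : ℕ) (e : Fin n → ℕ → ℝ) : ℕ → ℕ → ℝ := fun i =>
  if h : i < n then e ⟨i, h⟩ else fun k => if k = 1 then 1 else 0

/-- Law of the first `n` generations of an i.i.d. environment with marginal `ν`. -/
def envPi (ν : Measure (ℕ → ℝ)) [SigmaFinite ν] (n : ℕ) :
    Measure (Fin n → ℕ → ℝ) :=
  Measure.pi fun _ : Fin n => ν

/-- Annealed probability `P_k(Z_n = j)` of the BPRE whose environment is i.i.d. with
marginal law `ν`. -/
def aP (ν : Measure (ℕ → ℝ)) [SigmaFinite ν] (n k j : ℕ) : ℝ :=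
  ∫ e, qtrans (extEnv n e) n k j ∂(envPi ν n)

/-- The set `𝓘 = {j ≥ 1 : P(Q(j) > 0, Q(0) > 0) > 0}`. -/
def Iset (ν : Measure (ℕ → ℝ)) : Set ℕ :=
  {j | 1 ≤ j ∧ 0 < ν {q | 0 < q j ∧ 0 < q 0}}

/-- The set `Cl(𝓘)` of states reachable from `𝓘`. -/
def clI (ν : Measure (ℕ → ℝ)) [SigmaFinite ν] : Set ℕ :=
  {k | 1 ≤ k ∧ ∃ n, ∃ j ∈ Iset ν, 0 < aP ν n j k}

/-- The set `Cl({z})` of states reachable from `z`. -/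
def clz (ν : Measure (ℕ → ℝ)) [SigmaFinite ν] (z : ℕ) : Set ℕ :=
  {k | 1 ≤ k ∧ ∃ n, 0 < aP ν n z k}

/-- The spine (Geiger) expectation
`E[Q_n(z₀) f_{0,n}(0)^{z₀-1} ∏_{i=1}^{n-1} f_i'(f_{i,n}(0))]`. -/
def geigerExp (ν : Measure (ℕ → ℝ)) [SigmaFinite ν] (z₀ n : ℕ) : ℝ :=
  ∫ e, (extEnv n e (n - 1)) z₀ * (Fcomp (extEnv n e) 0 n 0) ^ (z₀ - 1) *
      ∏ i ∈ Finset.Icc 1 (n - 1), dpgf (extEnv n e (i - 1)) (Fcomp (extEnv n e) i n 0)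
    ∂(envPi ν n)

/-- `Λ(0) = - log inf_{λ ≥ 0} E[e^{-λ X}]`, the rate function of `S` at `0`. -/
def Lam0 (ν : Measure (ℕ → ℝ)) : ℝ :=
  - Real.log (sInf ((fun l : ℝ => ∫ q, Real.exp (-(l * envX q)) ∂ν) '' {l : ℝ | 0 ≤ l}))

/-- Truncated standardized second moment `ξ_q(a)`. -/
def xi (q : ℕ → ℝ) (a : ℕ) : ℝ :=
  (∑' y : ℕ, if a ≤ y then (y : ℝ) ^ 2 * q y else 0) / (pmfMean q) ^ 2

/-- Assumption A2 : the random walk is non-lattice and a truncated moment condition holds. -/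
def AssumptionA2 (ν : Measure (ℕ → ℝ)) : Prop :=
  (∀ r : ℝ, 0 < r → ν {q | ∃ m : ℤ, envX q = r * m} < 1) ∧
  ∃ ε : ℝ, 0 < ε ∧ ∃ a : ℕ, ∀ x : ℝ, 0 < x →
    IntegrableOn (fun q => Real.log (max (xi q a) 1) ^ ((2 : ℝ) + ε))
      {q | -x < envX q} ν

/-- `q` has a linear fractional generating function with mean `m = pmfMean q` and
second derivative `b` at `1`. -/
def IsLF (q : ℕ → ℝ) : Prop :=
  0 < pmfMean q ∧ ∃ b : ℝ, 0 ≤ b ∧ ∀ s ∈ Set.Icc (0 : ℝ) 1,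
    pgf q s = 1 - (1 - s) / ((pmfMean q)⁻¹ + b * ((pmfMean q) ^ 2)⁻¹ * (1 - s) / 2)

section Helpers
open scoped ENNReal

def xConv (q r : ℕ → ℝ≥0∞) (k : ℕ) : ℝ≥0∞ := ∑ p ∈ Finset.HasAntidiagonal.antidiagonal k, q p.1 * r p.2

def xPow (q : ℕ → ℝ≥0∞) : ℕ → ℕ → ℝ≥0∞
  | 0 => fun k => if k = 0 then 1 else 0
  | z + 1 => xConv q (xPow q z)

def xTr (e : ℕ → ℕ → ℝ≥0∞) : ℕ → ℕ → ℕ → ℝ≥0∞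
  | 0, k, j => if j = k then 1 else 0
  | n + 1, k, j => ∑' i : ℕ, xTr e n k i * xPow (e n) i j

def xG (q : ℕ → ℝ≥0∞) (s : ℝ≥0∞) : ℝ≥0∞ := ∑' k, q k * s ^ k

def xD (q : ℕ → ℝ≥0∞) (s : ℝ≥0∞) : ℝ≥0∞ := ∑' k : ℕ, (k : ℝ≥0∞) * q k * s ^ (k - 1)

def xF (e : ℕ → ℕ → ℝ≥0∞) (i n : ℕ) (s : ℝ≥0∞) : ℝ≥0∞ :=
  (List.range (n - i)).foldr (fun m t => xG (e (i + m)) t) s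

lemma tsum_antidiag (g : ℕ → ℕ → ℝ≥0∞) :
    ∑' k, ∑ p ∈ Finset.HasAntidiagonal.antidiagonal k, g p.1 p.2 = ∑' i, ∑' j, g i j := by
  rw [← ENNReal.tsum_prod (f := g),
    ← (Finset.HasAntidiagonal.sigmaAntidiagonalEquivProd (A := ℕ)).tsum_eq, ENNReal.tsum_sigma']
  congr 1; ext k
  rw [tsum_fintype, ← Finset.sum_attach]
  rfl

lemma xG_conv (q r : ℕ → ℝ≥0∞) (s) : xG (xConv q r) s = xG q s * xG r s := by
  unfold xG xConv
  rw [← ENNReal.tsum_mul_right]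
  simp_rw [← ENNReal.tsum_mul_left]
  rw [← tsum_antidiag]
  congr 1; ext k
  rw [Finset.sum_mul]
  refine Finset.sum_congr rfl fun p hp => ?_
  rw [← Finset.HasAntidiagonal.mem_antidiagonal.1 hp, pow_add]; ring

lemma xD_conv (q r : ℕ → ℝ≥0∞) (s) :
    xD (xConv q r) s = xD q s * xG r s + xG q s * xD r s := by
  unfold xG xD xConv
  rw [← ENNReal.tsum_mul_right, ← ENNReal.tsum_mul_right]
  simp_rw [← ENNReal.tsum_mul_left]
  rw [← ENNReal.tsum_add]
  simp_rw [← ENNReal.tsum_add]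
  rw [← tsum_antidiag]
  congr 1; ext k
  rw [Finset.mul_sum, Finset.sum_mul]
  refine Finset.sum_congr rfl fun p hp => ?_
  obtain ⟨a, b⟩ := p
  rw [← Finset.HasAntidiagonal.mem_antidiagonal.1 hp]
  rcases a with _ | a
  · simp; ring
  · rcases b with _ | b
    · simp; ring
    · have e1 : a + 1 + (b + 1) - 1 = a + b + 1 := by omega
      simp only [e1, Nat.add_sub_cancel]
      push_cast
      ring

lemma xG_pow (q : ℕ → ℝ≥0∞) (s) (i : ℕ) : xG (xPow q i) s = xG q s ^ i := by
  induction i with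
  | zero =>
    simp only [xG, xPow, pow_zero]
    rw [tsum_eq_single 0]
    · simp
    · intro b hb; simp [hb]
  | succ i ih => rw [xPow, xG_conv, ih, pow_succ']

lemma xD_pow (q : ℕ → ℝ≥0∞) (s) (i : ℕ) :
    xD (xPow q i) s = i * xG q s ^ (i - 1) * xD q s := by
  induction i with
  | zero =>
    simp only [xD, xPow]
    rw [ENNReal.tsum_eq_zero.2]
    · simp
    · intro b; rcases b with _ | b <;> simp
  | succ i ih =>
    rw [xPow, xD_conv, ih, xG_pow]
    rcases i with _ | i
    · simp
    · simp only [Nat.add_sub_cancel]; push_cast; ring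

lemma xPow_zero (q : ℕ → ℝ≥0∞) (l : ℕ) : xPow q l 0 = q 0 ^ l := by
  induction l with
  | zero => simp [xPow]
  | succ l ih => simp [xPow, xConv, ih, pow_succ']

lemma xPow_ge (q : ℕ → ℝ≥0∞) (l : ℕ) {z : ℕ} (hz : 1 ≤ z) :
    l * q z * q 0 ^ (l - 1) ≤ xPow q l z := by
  induction l with
  | zero => simp
  | succ l ih =>
    have h : q 0 * xPow q l z + q z * xPow q l 0 ≤ xPow q (l + 1) z := by
      rw [xPow, xConv]
      have : ({(0, z), (z, 0)} : Finset (ℕ × ℕ)) ⊆ Finset.HasAntidiagonal.antidiagonal z := by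
        intro p hp
        simp only [Finset.mem_insert, Finset.mem_singleton] at hp
        rcases hp with rfl | rfl <;> simp
      refine le_trans (le_of_eq ?_) (Finset.sum_le_sum_of_subset this)
      rw [Finset.sum_pair]
      intro h
      have := congrArg Prod.fst h
      simp at this; omega
    refine le_trans ?_ h
    rw [xPow_zero]
    refine le_trans (le_of_eq ?_) (add_le_add_left (mul_le_mul_right ih (q 0)) _)
    rcases l with _ | l
    · simp
    · simp only [Nat.add_sub_cancel]; push_cast; ring

lemma xD_tr (e : ℕ → ℕ → ℝ≥0∞) (n k : ℕ) (s) :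
    xD (xTr e (n + 1) k) s = xD (xTr e n k) (xG (e n) s) * xD (e n) s := by
  have : xD (xTr e (n + 1) k) s = ∑' i, xTr e n k i * xD (xPow (e n) i) s := by
    simp only [xD, xTr, ← ENNReal.tsum_mul_left, ← ENNReal.tsum_mul_right]
    rw [ENNReal.tsum_comm]
    refine tsum_congr fun i => tsum_congr fun l => by ring
  rw [this]
  simp only [xD_pow]
  conv_rhs => rw [xD, ← ENNReal.tsum_mul_right]
  refine tsum_congr fun i => by ring

lemma xF_succ (e : ℕ → ℕ → ℝ≥0∞) {i n : ℕ} (h : i ≤ n) (s) :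
    xF e i (n + 1) s = xF e i n (xG (e n) s) := by
  unfold xF
  rw [show n + 1 - i = (n - i) + 1 by omega, List.range_succ, List.foldr_append]
  simp [Nat.add_sub_cancel' h]

lemma xD_tr_eq (e : ℕ → ℕ → ℝ≥0∞) (n k : ℕ) (s) :
    xD (xTr e n k) s = k * xF e 0 n s ^ (k - 1) *
      ∏ i ∈ Finset.Icc 1 n, xD (e (i - 1)) (xF e i n s) := by
  induction n generalizing s with
  | zero =>
    simp only [xD, xTr]
    rw [tsum_eq_single k]
    · simp [xF]
    · intro b hb; simp [hb]
  | succ n ih =>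
    rw [xD_tr, ih, Finset.prod_Icc_succ_top (by omega), xF_succ e (Nat.zero_le n)]
    have h2 : xF e (n + 1) (n + 1) s = s := by simp [xF]
    rw [h2, Nat.add_sub_cancel, ← mul_assoc]
    congr 2
    refine Finset.prod_congr rfl fun i hi => ?_
    rw [xF_succ e (Finset.mem_Icc.1 hi).2]

/-- ENNReal Geiger integrand. -/
def xGei (e : ℕ → ℕ → ℝ≥0∞) (z n : ℕ) : ℝ≥0∞ :=
  e (n - 1) z * xF e 0 n 0 ^ (z - 1) * ∏ i ∈ Finset.Icc 1 (n - 1), xD (e (i - 1)) (xF e i n 0)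

lemma xG_zero (q : ℕ → ℝ≥0∞) : xG q 0 = q 0 := by
  rw [xG, tsum_eq_single 0]
  · simp
  · intro b hb; simp [hb]

lemma xGei_eq (e : ℕ → ℕ → ℝ≥0∞) (z n : ℕ) :
    z * xGei e z (n + 1) = e n z * xD (xTr e n z) (e n 0) := by
  rw [xD_tr_eq, xGei, Nat.add_sub_cancel, xF_succ e (Nat.zero_le n), xG_zero]
  rw [Finset.prod_congr rfl fun i hi => by
    rw [xF_succ e (Finset.mem_Icc.1 hi).2, xG_zero]]
  ring

lemma xGei_le (e : ℕ → ℕ → ℝ≥0∞) {z : ℕ} (hz : 1 ≤ z) (n : ℕ) :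
    xGei e z (n + 1) ≤ xTr e (n + 1) z z := by
  have h1 : xGei e z (n + 1) ≤ z * xGei e z (n + 1) :=
    le_mul_of_one_le_left (zero_le) (by exact_mod_cast hz)
  refine h1.trans ?_
  rw [xGei_eq, xTr, xD, ← ENNReal.tsum_mul_left]
  refine ENNReal.tsum_le_tsum fun i => ?_
  refine le_trans (le_of_eq ?_) (mul_le_mul_right (xPow_ge (e n) i hz) _)
  ring

lemma xGei_ge (e : ℕ → ℕ → ℝ≥0∞) {z : ℕ} (hz : 1 ≤ z) (n : ℕ) :
    xTr e n z z * (e n z * e n 0 ^ (z - 1)) ≤ xGei e z (n + 1) := by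
  have hz0 : (z : ℝ≥0∞) ≠ 0 := by exact_mod_cast (by omega : z ≠ 0)
  rw [← ENNReal.mul_le_mul_iff_right hz0 (ENNReal.natCast_ne_top z), xGei_eq, xD]
  refine le_trans (le_of_eq ?_) (mul_le_mul_right (ENNReal.le_tsum z) _)
  ring

lemma xPow_sum {q : ℕ → ℝ≥0∞} (hq : ∑' k, q k = 1) (i : ℕ) : ∑' j, xPow q i j = 1 := by
  have := xG_pow q 1 i
  simpa [xG, hq] using this

lemma xTr_sum {e : ℕ → ℕ → ℝ≥0∞} (he : ∀ i, ∑' k, e i k = 1) (n k : ℕ) :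
    ∑' j, xTr e n k j = 1 := by
  induction n with
  | zero => simp [xTr]
  | succ n ih =>
    simp only [xTr]
    rw [ENNReal.tsum_comm]
    simp only [ENNReal.tsum_mul_left, xPow_sum (he n), mul_one, ih]

/-- pointwise lift to ENNReal -/
def up (e : ℕ → ℕ → ℝ) : ℕ → ℕ → ℝ≥0∞ := fun i k => ENNReal.ofReal (e i k)

lemma IsPMF.tsum_up {q : ℕ → ℝ} (hq : IsPMF q) : ∑' k, ENNReal.ofReal (q k) = 1 := by
  have hs : Summable q := by
    by_contra h
    have := hq.2
    rw [tsum_eq_zero_of_not_summable h] at this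
    exact zero_ne_one this
  rw [← ENNReal.ofReal_tsum_of_nonneg hq.1 hs, hq.2, ENNReal.ofReal_one]

lemma xPow_le_one {q : ℕ → ℝ≥0∞} (hq : ∑' k, q k = 1) (i j : ℕ) : xPow q i j ≤ 1 :=
  (ENNReal.le_tsum j).trans (xPow_sum hq i).le

lemma xTr_le_one {e : ℕ → ℕ → ℝ≥0∞} (he : ∀ i, ∑' k, e i k = 1) (n k j : ℕ) :
    xTr e n k j ≤ 1 :=
  (ENNReal.le_tsum j).trans (xTr_sum he n k).le

lemma convPow_eq {q : ℕ → ℝ} (hq : IsPMF q) (i j : ℕ) :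
    convPow q i j = (xPow (fun k => ENNReal.ofReal (q k)) i j).toReal := by
  induction i generalizing j with
  | zero => simp only [convPow, xPow]; split_ifs <;> simp
  | succ i ih =>
    simp only [convPow, xPow, conv, xConv]
    rw [ENNReal.toReal_sum, Finset.Nat.sum_antidiagonal_eq_sum_range_succ
      (fun a b => (ENNReal.ofReal (q a) * xPow (fun k => ENNReal.ofReal (q k)) i b).toReal)]
    · refine Finset.sum_congr rfl fun a _ => ?_
      rw [ENNReal.toReal_mul, ENNReal.toReal_ofReal (hq.1 a), ih]
    · intro p _
      exact ENNReal.mul_ne_top ENNReal.ofReal_ne_top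
        (ne_top_of_le_ne_top ENNReal.one_ne_top (xPow_le_one hq.tsum_up _ _))

lemma qtrans_eq {e : ℕ → ℕ → ℝ} (he : ∀ i, IsPMF (e i)) (n k j : ℕ) :
    qtrans e n k j = (xTr (up e) n k j).toReal := by
  induction n generalizing j with
  | zero => simp only [qtrans, xTr]; split_ifs <;> simp
  | succ n ih =>
    simp only [qtrans, xTr]
    rw [ENNReal.tsum_toReal_eq]
    · refine tsum_congr fun i => ?_
      rw [ENNReal.toReal_mul, ih, convPow_eq (he n)]; rfl
    · intro i
      refine ENNReal.mul_ne_top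
        (ne_top_of_le_ne_top ENNReal.one_ne_top (xTr_le_one (fun i => (he i).tsum_up) _ _ _))
        (ne_top_of_le_ne_top ENNReal.one_ne_top (xPow_le_one (he n).tsum_up _ _))

lemma pgf_eq {q : ℕ → ℝ} (hq : IsPMF q) {t : ℝ≥0∞} (ht : t ≠ ∞) :
    pgf q t.toReal = (xG (fun k => ENNReal.ofReal (q k)) t).toReal := by
  rw [pgf, xG, ENNReal.tsum_toReal_eq]
  · refine tsum_congr fun i => ?_
    rw [ENNReal.toReal_mul, ENNReal.toReal_ofReal (hq.1 i), ENNReal.toReal_pow]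
  · intro i
    exact ENNReal.mul_ne_top ENNReal.ofReal_ne_top (ENNReal.pow_ne_top ht)

lemma dpgf_eq {q : ℕ → ℝ} (hq : IsPMF q) {t : ℝ≥0∞} (ht : t ≠ ∞) :
    dpgf q t.toReal = (xD (fun k => ENNReal.ofReal (q k)) t).toReal := by
  rw [dpgf, xD, ENNReal.tsum_toReal_eq]
  · refine tsum_congr fun i => ?_
    rw [ENNReal.toReal_mul, ENNReal.toReal_mul, ENNReal.toReal_ofReal (hq.1 i),
      ENNReal.toReal_pow, ENNReal.toReal_natCast]
  · intro i
    exact ENNReal.mul_ne_top (ENNReal.mul_ne_top (ENNReal.natCast_ne_top i) ENNReal.ofReal_ne_top)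
      (ENNReal.pow_ne_top ht)

lemma xG_le_one {q : ℕ → ℝ≥0∞} (hq : ∑' k, q k = 1) {t : ℝ≥0∞} (ht : t ≤ 1) : xG q t ≤ 1 := by
  rw [← hq]
  exact ENNReal.tsum_le_tsum fun k => mul_le_of_le_one_right zero_le (pow_le_one₀ zero_le ht)

lemma Fcomp_aux {e : ℕ → ℕ → ℝ} (he : ∀ i, IsPMF (e i)) (i : ℕ) (l : List ℕ) :
    l.foldr (fun m t => xG (up e (i + m)) t) 0 ≤ 1 ∧
    l.foldr (fun m t => pgf (e (i + m)) t) 0 =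
      (l.foldr (fun m t => xG (up e (i + m)) t) 0).toReal := by
  induction l with
  | nil => simp
  | cons a l ih =>
    simp only [List.foldr_cons]
    refine ⟨xG_le_one (he _).tsum_up ih.1, ?_⟩
    rw [ih.2, pgf_eq (he _) (ne_top_of_le_ne_top ENNReal.one_ne_top ih.1)]; rfl

lemma gei_eq {e : ℕ → ℕ → ℝ} (he : ∀ i, IsPMF (e i)) (z n : ℕ) :
    e (n - 1) z * (Fcomp e 0 n 0) ^ (z - 1) *
      ∏ i ∈ Finset.Icc 1 (n - 1), dpgf (e (i - 1)) (Fcomp e i n 0)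
    = (xGei (up e) z n).toReal := by
  have hF : ∀ i, Fcomp e i n 0 = (xF (up e) i n 0).toReal := fun i => (Fcomp_aux he i _).2
  have hF' : ∀ i, xF (up e) i n 0 ≤ 1 := fun i => (Fcomp_aux he i _).1
  rw [xGei, ENNReal.toReal_mul, ENNReal.toReal_mul, ENNReal.toReal_pow, ENNReal.toReal_prod, ← hF]
  congr 1
  · rw [up, ENNReal.toReal_ofReal ((he _).1 _)]
  · refine Finset.prod_congr rfl fun i _ => ?_
    rw [hF, dpgf_eq (he _) (ne_top_of_le_ne_top ENNReal.one_ne_top (hF' i))]; rfl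

lemma xPow_meas {α : Type*} [MeasurableSpace α] {q : α → ℕ → ℝ≥0∞}
    (hq : ∀ k, Measurable fun a => q a k) (i j : ℕ) : Measurable fun a => xPow (q a) i j := by
  induction i generalizing j with
  | zero => simp only [xPow]; exact measurable_const
  | succ i ih =>
    simp only [xPow, xConv]
    exact Finset.measurable_sum _ fun p _ => (hq _).mul (ih _)

lemma xTr_meas {α : Type*} [MeasurableSpace α] {e : α → ℕ → ℕ → ℝ≥0∞}
    (he : ∀ i k, Measurable fun a => e a i k) (n k j : ℕ) : Measurable fun a => xTr (e a) n k j := by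
  induction n generalizing j with
  | zero => simp only [xTr]; exact measurable_const
  | succ n ih =>
    simp only [xTr]
    exact Measurable.ennreal_tsum fun i => (ih i).mul (xPow_meas (he n) i j)

lemma xG_meas {α : Type*} [MeasurableSpace α] {q : α → ℕ → ℝ≥0∞}
    (hq : ∀ k, Measurable fun a => q a k) {t : α → ℝ≥0∞} (ht : Measurable t) :
    Measurable fun a => xG (q a) (t a) :=
  Measurable.ennreal_tsum fun i => (hq i).mul (ht.pow_const i)

lemma xD_meas {α : Type*} [MeasurableSpace α] {q : α → ℕ → ℝ≥0∞}
    (hq : ∀ k, Measurable fun a => q a k) {t : α → ℝ≥0∞} (ht : Measurable t) :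
    Measurable fun a => xD (q a) (t a) :=
  Measurable.ennreal_tsum fun i => ((hq i).const_mul _).mul (ht.pow_const _)

lemma xF_meas {α : Type*} [MeasurableSpace α] {e : α → ℕ → ℕ → ℝ≥0∞}
    (he : ∀ i k, Measurable fun a => e a i k) (i n : ℕ) :
    Measurable fun a => xF (e a) i n 0 := by
  unfold xF
  induction List.range (n - i) with
  | nil => simp
  | cons m l ih => simp only [List.foldr_cons]; exact xG_meas (he _) ih

lemma xGei_meas {α : Type*} [MeasurableSpace α] {e : α → ℕ → ℕ → ℝ≥0∞}
    (he : ∀ i k, Measurable fun a => e a i k) (z n : ℕ) :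
    Measurable fun a => xGei (e a) z n := by
  unfold xGei
  exact ((he _ _).mul ((xF_meas he 0 n).pow_const _)).mul
    (Finset.measurable_prod _ fun i _ => xD_meas (he _) (xF_meas he i n))

lemma up_meas (n : ℕ) (i k : ℕ) :
    Measurable fun e : Fin n → ℕ → ℝ => up (extEnv n e) i k := by
  unfold up extEnv
  by_cases h : i < n
  · simp only [h, dif_pos]
    exact ((measurable_pi_apply k).comp (measurable_pi_apply (⟨i, h⟩ : Fin n))).ennreal_ofReal
  · simp only [h, dif_neg, not_false_eq_true]
    exact measurable_const

lemma ext_pmf {n : ℕ} {e : Fin n → ℕ → ℝ} (he : ∀ i, IsPMF (e i)) (i : ℕ) :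
    IsPMF (extEnv n e i) := by
  unfold extEnv
  split_ifs with h
  · exact he _
  · refine ⟨fun k => by dsimp only; split_ifs <;> simp, by simp⟩

lemma ae_pmf {ν : Measure (ℕ → ℝ)} [IsProbabilityMeasure ν] (hpmf : ∀ᵐ q ∂ν, IsPMF q) (n : ℕ) :
    ∀ᵐ e ∂(envPi ν n), ∀ i, IsPMF (extEnv n e i) := by
  have : ∀ᵐ e ∂(envPi ν n), ∀ i : Fin n, IsPMF (e i) := by
    rw [ae_all_iff]
    intro i
    exact (measurePreserving_eval (fun _ : Fin n => ν) i).quasiMeasurePreserving.ae hpmf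
  filter_upwards [this] with e he using ext_pmf he

/-- annealed ENNReal transition probability -/
def xP (ν : Measure (ℕ → ℝ)) [SigmaFinite ν] (n k j : ℕ) : ℝ≥0∞ :=
  ∫⁻ e, xTr (up (extEnv n e)) n k j ∂(envPi ν n)

def xA (ν : Measure (ℕ → ℝ)) (k j : ℕ) : ℝ≥0∞ :=
  ∫⁻ q, xPow (fun k => ENNReal.ofReal (q k)) k j ∂ν

lemma aP_eq {ν : Measure (ℕ → ℝ)} [IsProbabilityMeasure ν] (hpmf : ∀ᵐ q ∂ν, IsPMF q)
    (n k j : ℕ) : aP ν n k j = (xP ν n k j).toReal := by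
  rw [aP, xP, ← integral_toReal (xTr_meas (up_meas n) n k j).aemeasurable]
  · refine integral_congr_ae ?_
    filter_upwards [ae_pmf hpmf n] with e he using qtrans_eq he n k j
  · filter_upwards [ae_pmf hpmf n] with e he
    exact (xTr_le_one (fun i => (he i).tsum_up) _ _ _).trans_lt ENNReal.one_lt_top

def xGe (ν : Measure (ℕ → ℝ)) [SigmaFinite ν] (z n : ℕ) : ℝ≥0∞ :=
  ∫⁻ e, xGei (up (extEnv n e)) z n ∂(envPi ν n)

lemma gE_eq {ν : Measure (ℕ → ℝ)} [IsProbabilityMeasure ν] (hpmf : ∀ᵐ q ∂ν, IsPMF q)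
    {z : ℕ} (hz : 1 ≤ z) (n : ℕ) : geigerExp ν z (n + 1) = (xGe ν z (n + 1)).toReal := by
  rw [geigerExp, xGe, ← integral_toReal (xGei_meas (up_meas (n + 1)) z (n + 1)).aemeasurable]
  · refine integral_congr_ae ?_
    filter_upwards [ae_pmf hpmf (n + 1)] with e he using gei_eq he z (n + 1)
  · filter_upwards [ae_pmf hpmf (n + 1)] with e he
    exact ((xGei_le _ hz n).trans
      (xTr_le_one (fun i => (he i).tsum_up) _ _ _)).trans_lt ENNReal.one_lt_top

lemma xP_le_one {ν : Measure (ℕ → ℝ)} [IsProbabilityMeasure ν] (hpmf : ∀ᵐ q ∂ν, IsPMF q)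
    (n k j : ℕ) : xP ν n k j ≤ 1 := by
  have : IsProbabilityMeasure (envPi ν n) := by unfold envPi; infer_instance
  calc xP ν n k j ≤ ∫⁻ e, 1 ∂(envPi ν n) := by
        refine lintegral_mono_ae ?_
        filter_upwards [ae_pmf hpmf n] with e he
        exact xTr_le_one (fun i => (he i).tsum_up) _ _ _
    _ = 1 := by simp

lemma xGe_le {ν : Measure (ℕ → ℝ)} [IsProbabilityMeasure ν]
    {z : ℕ} (hz : 1 ≤ z) (n : ℕ) : xGe ν z (n + 1) ≤ xP ν (n + 1) z z :=
  lintegral_mono fun _ => xGei_le _ hz n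

lemma xTr_congr {e e' : ℕ → ℕ → ℝ≥0∞} {n : ℕ} (h : ∀ i < n, e i = e' i) (k j : ℕ) :
    xTr e n k j = xTr e' n k j := by
  induction n generalizing j with
  | zero => rfl
  | succ n ih =>
    simp only [xTr]
    refine tsum_congr fun i => ?_
    rw [ih (fun i hi => h i (by omega)), h n (by omega)]

lemma lintegral_split (ν : Measure (ℕ → ℝ)) [IsProbabilityMeasure ν] (n : ℕ)
    {f : (Fin n → ℕ → ℝ) → ℝ≥0∞} {g : (ℕ → ℝ) → ℝ≥0∞} (hf : Measurable f) (hg : Measurable g) :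
    ∫⁻ e, f (fun i => e i.castSucc) * g (e (Fin.last n)) ∂(envPi ν (n + 1)) =
      (∫⁻ e, f e ∂(envPi ν n)) * ∫⁻ q, g q ∂ν := by
  have h := measurePreserving_piFinSuccAbove (fun _ : Fin (n + 1) => ν) (Fin.last n)
  have h2 := h.lintegral_comp (f := fun p => f p.2 * g p.1)
    ((hf.comp measurable_snd).mul (hg.comp measurable_fst))
  have : IsProbabilityMeasure (envPi ν n) := by unfold envPi; infer_instance
  have h3 := lintegral_prod_mul (μ := ν) (ν := envPi ν n) hg.aemeasurable hf.aemeasurable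
  rw [mul_comm, ← h3]
  simp only [mul_comm (g _)]
  rw [envPi, envPi, ← h2]
  refine lintegral_congr fun e => ?_
  simp [MeasurableEquiv.piFinSuccAbove, Fin.insertNthEquiv]
  rfl

lemma up_castSucc (n : ℕ) (e : Fin (n + 1) → ℕ → ℝ) :
    ∀ i < n, up (extEnv (n + 1) e) i = up (extEnv n (fun i => e i.castSucc)) i := by
  intro i hi
  ext k
  simp [up, extEnv, hi, Nat.lt_succ_of_lt hi]

lemma up_last (n : ℕ) (e : Fin (n + 1) → ℕ → ℝ) :
    up (extEnv (n + 1) e) n = fun k => ENNReal.ofReal (e (Fin.last n) k) := by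
  ext k
  simp [up, extEnv, Fin.last]

lemma ofReal_meas (k : ℕ) : Measurable fun q : ℕ → ℝ => ENNReal.ofReal (q k) :=
  (measurable_pi_apply k).ennreal_ofReal

lemma xP_succ (ν : Measure (ℕ → ℝ)) [IsProbabilityMeasure ν] (n k j : ℕ) :
    xP ν (n + 1) k j = ∑' i, xP ν n k i * xA ν i j := by
  rw [xP]
  simp only [xTr]
  rw [lintegral_tsum]
  · refine tsum_congr fun i => ?_
    rw [xP, xA, ← lintegral_split ν n (xTr_meas (up_meas n) n k i) (xPow_meas ofReal_meas i j)]
    refine lintegral_congr fun e => ?_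
    rw [xTr_congr (up_castSucc n e), up_last]
  · intro i
    exact ((xTr_meas (up_meas _) n k i).mul (xPow_meas (up_meas _ n) i j)).aemeasurable

lemma xP_zero (ν : Measure (ℕ → ℝ)) [IsProbabilityMeasure ν] (k j : ℕ) :
    xP ν 0 k j = if j = k then 1 else 0 := by
  have : IsProbabilityMeasure (envPi ν 0) := by unfold envPi; infer_instance
  simp [xP, xTr]

lemma xP_one (ν : Measure (ℕ → ℝ)) [IsProbabilityMeasure ν] (k j : ℕ) :
    xP ν 1 k j = xA ν k j := by
  rw [xP_succ, tsum_eq_single k]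
  · simp [xP_zero]
  · intro b hb; simp [xP_zero, hb]

lemma xP_mul (ν : Measure (ℕ → ℝ)) [IsProbabilityMeasure ν] (n m k i j : ℕ) :
    xP ν n k i * xP ν m i j ≤ xP ν (n + m) k j := by
  induction m generalizing j with
  | zero =>
    rw [xP_zero]
    split_ifs with h
    · simp [h]
    · simp
  | succ m ih =>
    rw [xP_succ, ← add_assoc, xP_succ, ← ENNReal.tsum_mul_left]
    refine ENNReal.tsum_le_tsum fun l => ?_
    rw [← mul_assoc]
    exact mul_le_mul_left (ih l) _

lemma c_meas (z m : ℕ) : Measurable fun q : ℕ → ℝ =>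
    ENNReal.ofReal (q z) * ENNReal.ofReal (q 0) ^ m :=
  (ofReal_meas z).mul ((ofReal_meas 0).pow_const _)

lemma xGe_ge (ν : Measure (ℕ → ℝ)) [IsProbabilityMeasure ν] {z : ℕ} (hz : 1 ≤ z) (n : ℕ) :
    xP ν n z z * ∫⁻ q, ENNReal.ofReal (q z) * ENNReal.ofReal (q 0) ^ (z - 1) ∂ν
      ≤ xGe ν z (n + 1) := by
  rw [xP, ← lintegral_split ν n (xTr_meas (up_meas n) n z z)
    (c_meas z (z - 1)), xGe]
  refine lintegral_mono fun e => ?_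
  have := xGei_ge (up (extEnv (n + 1) e)) hz n
  rwa [xTr_congr (up_castSucc n e), up_last] at this

lemma c_pos (ν : Measure (ℕ → ℝ)) [IsProbabilityMeasure ν] {z : ℕ} (hz : z ∈ Iset ν) (m : ℕ) :
    0 < ∫⁻ q, ENNReal.ofReal (q z) * ENNReal.ofReal (q 0) ^ m ∂ν := by
  rw [lintegral_pos_iff_support (c_meas z m)]
  refine hz.2.trans_le (measure_mono ?_)
  rintro q ⟨h1, h2⟩
  rw [Function.mem_support]
  exact mul_ne_zero (ENNReal.ofReal_pos.2 h1).ne' (pow_ne_zero _ (ENNReal.ofReal_pos.2 h2).ne')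

lemma xP_one_pos (ν : Measure (ℕ → ℝ)) [IsProbabilityMeasure ν] {k j : ℕ} (hk : 1 ≤ k)
    (hj : j ∈ Iset ν) : 0 < xP ν 1 k j := by
  rw [xP_one]
  refine (c_pos ν hj (k - 1)).trans_le (lintegral_mono fun q => ?_)
  refine le_trans ?_ (xPow_ge _ k hj.1)
  rw [mul_assoc]
  exact le_mul_of_one_le_left zero_le (by exact_mod_cast hk)

/-- comparison of exponential rates -/
lemma rate_compare {x y : ℕ → ℝ} {L : ℝ} (hx : ∀ n, 0 ≤ x n) (hy : ∀ n, 0 < y n)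
    (hL : Tendsto (fun n : ℕ => (1 / (n : ℝ)) * Real.log (y n)) atTop (𝓝 L))
    {a b : ℕ} {c d : ℝ} (hc : 0 < c) (hd : 0 < d)
    (h1 : ∀ n, c * y n ≤ x (n + a)) (h2 : ∀ᶠ n in atTop, d * x n ≤ y (n + b)) :
    Tendsto (fun n : ℕ => (1 / (n : ℝ)) * Real.log (x n)) atTop (𝓝 L) := by
  have e0 : Tendsto (fun n : ℕ => 1 / (n : ℝ)) atTop (𝓝 0) := tendsto_one_div_atTop_nhds_zero_nat
  -- lower bound, along n + a
  have ratio : ∀ r : ℕ, Tendsto (fun n : ℕ => ((n : ℝ)) / ((n + r : ℕ) : ℝ)) atTop (𝓝 1) := by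
    intro r
    have := tendsto_natCast_div_add_atTop (𝕜 := ℝ) (r : ℝ)
    simpa using this
  have xpos : ∀ n, 0 < x (n + a) := fun n => (mul_pos hc (hy n)).trans_le (h1 n)
  rw [← tendsto_add_atTop_iff_nat a]
  have low : Tendsto (fun n : ℕ => (1 / ((n + a : ℕ) : ℝ)) * Real.log c +
      ((n : ℝ) / ((n + a : ℕ) : ℝ)) * ((1 / (n : ℝ)) * Real.log (y n))) atTop (𝓝 L) := by
    have := (((tendsto_add_atTop_iff_nat a).2 e0).mul_const (Real.log c)).add ((ratio a).mul hL)
    simpa using this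
  have upp : Tendsto (fun n : ℕ => (((n + a + b : ℕ) : ℝ) / ((n + a : ℕ) : ℝ)) *
      ((1 / ((n + a + b : ℕ) : ℝ)) * Real.log (y (n + a + b))) -
      (1 / ((n + a : ℕ) : ℝ)) * Real.log d) atTop (𝓝 L) := by
    have r2 : Tendsto (fun n : ℕ => ((n + b : ℕ) : ℝ) / (n : ℝ)) atTop (𝓝 1) := by
      have := (ratio b).inv₀ one_ne_zero
      simpa using this
    have l2 := (tendsto_add_atTop_iff_nat b).2 hL
    have := (r2.mul l2).sub (e0.mul_const (Real.log d))
    have := (tendsto_add_atTop_iff_nat a).2 this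
    simpa using this
  refine tendsto_of_tendsto_of_tendsto_of_le_of_le' low upp ?_ ?_
  · filter_upwards [eventually_gt_atTop 0] with n hn
    have hn' : (0 : ℝ) < n := by exact_mod_cast hn
    have ha : (0 : ℝ) < ((n + a : ℕ) : ℝ) := by exact_mod_cast (by omega : 0 < n + a)
    have := Real.log_le_log (mul_pos hc (hy n)) (h1 n)
    rw [Real.log_mul hc.ne' (hy n).ne'] at this
    have e1 : (1 / ((n + a : ℕ) : ℝ)) * Real.log c +
      ((n : ℝ) / ((n + a : ℕ) : ℝ)) * ((1 / (n : ℝ)) * Real.log (y n)) =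
      (1 / ((n + a : ℕ) : ℝ)) * (Real.log c + Real.log (y n)) := by
      field_simp
    rw [e1]
    exact mul_le_mul_of_nonneg_left this (by positivity)
  · filter_upwards [eventually_gt_atTop 0, (tendsto_add_atTop_nat a).eventually h2] with n hn h2
    have ha : (0 : ℝ) < ((n + a : ℕ) : ℝ) := by exact_mod_cast (by omega : 0 < n + a)
    have hb : (0 : ℝ) < ((n + a + b : ℕ) : ℝ) := by exact_mod_cast (by omega : 0 < n + a + b)
    have := Real.log_le_log (mul_pos hd (xpos n)) h2
    rw [Real.log_mul hd.ne' (xpos n).ne'] at this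
    have e1 : (((n + a + b : ℕ) : ℝ) / ((n + a : ℕ) : ℝ)) *
      ((1 / ((n + a + b : ℕ) : ℝ)) * Real.log (y (n + a + b))) -
      (1 / ((n + a : ℕ) : ℝ)) * Real.log d =
      (1 / ((n + a : ℕ) : ℝ)) * (Real.log (y (n + a + b)) - Real.log d) := by
      field_simp
    rw [e1]
    exact mul_le_mul_of_nonneg_left (by linarith) (by positivity)

lemma aP_mul {ν : Measure (ℕ → ℝ)} [IsProbabilityMeasure ν] (hpmf : ∀ᵐ q ∂ν, IsPMF q)
    (n m k i j : ℕ) : aP ν n k i * aP ν m i j ≤ aP ν (n + m) k j := by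
  rw [aP_eq hpmf, aP_eq hpmf, aP_eq hpmf, ← ENNReal.toReal_mul]
  exact ENNReal.toReal_mono (ne_top_of_le_ne_top ENNReal.one_ne_top (xP_le_one hpmf _ _ _))
    (xP_mul ν n m k i j)

lemma aP_nonneg {ν : Measure (ℕ → ℝ)} [IsProbabilityMeasure ν] (hpmf : ∀ᵐ q ∂ν, IsPMF q)
    (n k j : ℕ) : 0 ≤ aP ν n k j := by
  rw [aP_eq hpmf]; exact ENNReal.toReal_nonneg

lemma aP_le_one {ν : Measure (ℕ → ℝ)} [IsProbabilityMeasure ν] (hpmf : ∀ᵐ q ∂ν, IsPMF q)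
    (n k j : ℕ) : aP ν n k j ≤ 1 := by
  rw [aP_eq hpmf]
  exact ENNReal.toReal_mono ENNReal.one_ne_top (xP_le_one hpmf n k j)

lemma aP_one_pos {ν : Measure (ℕ → ℝ)} [IsProbabilityMeasure ν] (hpmf : ∀ᵐ q ∂ν, IsPMF q)
    {k j : ℕ} (hk : 1 ≤ k) (hj : j ∈ Iset ν) : 0 < aP ν 1 k j := by
  rw [aP_eq hpmf]
  exact ENNReal.toReal_pos (xP_one_pos ν hk hj).ne'
    (ne_top_of_le_ne_top ENNReal.one_ne_top (xP_le_one hpmf _ _ _))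

lemma reach {ν : Measure (ℕ → ℝ)} [IsProbabilityMeasure ν] (hpmf : ∀ᵐ q ∂ν, IsPMF q)
    {z k : ℕ} (hz : 1 ≤ z) (hk : k ∈ clI ν) : ∃ b, 0 < aP ν b z k := by
  obtain ⟨_, n, i, hi, h⟩ := hk
  exact ⟨1 + n, (mul_pos (aP_one_pos hpmf hz hi) h).trans_le (aP_mul hpmf 1 n z i k)⟩

end Helpers

theorem stmt0 (ν : Measure (ℕ → ℝ)) [IsProbabilityMeasure ν]
    (hpmf : ∀ᵐ q ∂ν, IsPMF q)
    (hXint : Integrable envX ν)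
    (hEX : 0 < ∫ q, envX q ∂ν)
    (hext : 0 < aP ν 1 1 0)
    (z₀ : ℕ) (hz₀ : z₀ ∈ Iset ν ∧ ∀ j ∈ Iset ν, z₀ ≤ j) :
    ∃ ρ : ℝ, 0 ≤ ρ ∧
      (∀ k ∈ clI ν, ∀ j ∈ clI ν,
        Tendsto (fun n : ℕ => (1 / (n : ℝ)) * Real.log (aP ν n k j)) atTop (𝓝 (-ρ))) ∧
      Tendsto (fun n : ℕ => (1 / (n : ℝ)) * Real.log (geigerExp ν z₀ n)) atTop (𝓝 (-ρ)) := by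
  obtain ⟨hz, -⟩ := hz₀
  have hz1 : 1 ≤ z₀ := hz.1
  have hy : ∀ n, 0 < aP ν n z₀ z₀ := by
    intro n
    induction n with
    | zero => rw [aP_eq hpmf, xP_zero]; simp
    | succ n ih =>
      exact (mul_pos ih (aP_one_pos hpmf hz1 hz)).trans_le (aP_mul hpmf n 1 z₀ z₀ z₀)
  have hsub : Subadditive fun n => - Real.log (aP ν n z₀ z₀) := by
    intro m n
    have := Real.log_le_log (mul_pos (hy m) (hy n)) (aP_mul hpmf m n z₀ z₀ z₀)
    rw [Real.log_mul (hy m).ne' (hy n).ne'] at this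
    linarith
  have hnn : ∀ n : ℕ, 0 ≤ - Real.log (aP ν n z₀ z₀) / (n : ℝ) := fun n =>
    div_nonneg (neg_nonneg.2 (Real.log_nonpos (hy n).le (aP_le_one hpmf _ _ _))) (Nat.cast_nonneg n)
  have hbdd : BddBelow (Set.range fun n : ℕ => - Real.log (aP ν n z₀ z₀) / (n : ℝ)) :=
    ⟨0, by rintro _ ⟨n, rfl⟩; exact hnn n⟩
  have hlim := hsub.tendsto_lim hbdd
  have hL : Tendsto (fun n : ℕ => (1 / (n : ℝ)) * Real.log (aP ν n z₀ z₀)) atTop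
      (𝓝 (-hsub.lim)) := by
    refine hlim.neg.congr fun n => ?_
    ring
  refine ⟨hsub.lim, ge_of_tendsto' hlim hnn, ?_, ?_⟩
  · intro k hk j hj
    obtain ⟨b, hb⟩ := reach hpmf hz1 hj
    obtain ⟨b', hb'⟩ := reach hpmf hz1 hk
    have hk1 := aP_one_pos hpmf hk.1 hz
    have hj1 := aP_one_pos hpmf hj.1 hz
    refine rate_compare (fun n => aP_nonneg hpmf n k j) hy hL (a := 1 + b) (b := b' + 1)
      (mul_pos hk1 hb) (mul_pos hb' hj1) (fun n => ?_) (Eventually.of_forall fun n => ?_)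
    · have h1 := aP_mul hpmf 1 n k z₀ z₀
      have h2 := aP_mul hpmf (1 + n) b k z₀ j
      rw [show n + (1 + b) = 1 + n + b by omega]
      refine le_trans ?_ h2
      refine le_trans (le_of_eq ?_) (mul_le_mul_of_nonneg_right h1 hb.le)
      ring
    · have h1 := aP_mul hpmf b' n z₀ k j
      have h2 := aP_mul hpmf (b' + n) 1 z₀ j z₀
      rw [show n + (b' + 1) = b' + n + 1 by omega]
      refine le_trans ?_ h2
      refine le_trans (le_of_eq ?_) (mul_le_mul_of_nonneg_right h1 hj1.le)
      ring
  · have hfin : ∀ n, xP ν n z₀ z₀ ≠ ⊤ := fun n =>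
      ne_top_of_le_ne_top ENNReal.one_ne_top (xP_le_one hpmf _ _ _)
    have hGfin : ∀ n, xGe ν z₀ (n + 1) ≠ ⊤ := fun n =>
      ne_top_of_le_ne_top (hfin (n + 1)) (xGe_le hz1 n)
    have hcpos := c_pos ν hz (z₀ - 1)
    have hcfin : ∫⁻ q, ENNReal.ofReal (q z₀) * ENNReal.ofReal (q 0) ^ (z₀ - 1) ∂ν ≠ ⊤ := by
      refine ne_top_of_le_ne_top (hGfin 0) ?_
      have := xGe_ge ν hz1 0
      simpa [xP_zero] using this
    rw [← tendsto_add_atTop_iff_nat 1]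
    have key : Tendsto (fun n : ℕ => (1 / (n : ℝ)) *
        Real.log (if n = 0 then 0 else geigerExp ν z₀ n)) atTop (𝓝 (-hsub.lim)) := by
      refine rate_compare (a := 1) (b := 0) (fun n => ?_) hy hL
        (ENNReal.toReal_pos hcpos.ne' hcfin) one_pos (fun n => ?_) ?_
      · rcases n with _ | n
        · simp
        · simp only [Nat.add_eq_zero_iff, one_ne_zero, and_false, if_false]
          rw [gE_eq hpmf hz1]; exact ENNReal.toReal_nonneg
      · simp only [Nat.add_eq_zero_iff, one_ne_zero, and_false, if_false]
        rw [gE_eq hpmf hz1, aP_eq hpmf, mul_comm, ← ENNReal.toReal_mul]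
        exact ENNReal.toReal_mono (hGfin n) (xGe_ge ν hz1 n)
      · filter_upwards [eventually_gt_atTop 0] with n hn
        obtain ⟨m, rfl⟩ : ∃ m, n = m + 1 := ⟨n - 1, by omega⟩
        simp only [Nat.add_eq_zero_iff, one_ne_zero, and_false, if_false]
        rw [gE_eq hpmf hz1, aP_eq hpmf, one_mul]
        exact ENNReal.toReal_mono (hfin _) (xGe_le hz1 m)
    have := (tendsto_add_atTop_iff_nat 1).2 key
    simpa using this

end
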